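/- For every n ≥ 1, the pair of statistics (asc, rep) is symmetric on the set of ascent sequences of length n: the number of ascent sequences s of length n with asc(s) = a and rep(s) = b equals the number with asc(s) = b and rep(s) = a. -/

import Mathlib

def ascN (s : List ℕ) : ℕ :=
  ((Finset.range (s.length - 1)).filter fun i => s.getD i 0 < s.getD (i+1) 0).card

def repN (s : List ℕ) : ℕ := s.length - s.dedup.length

def zeroN (s : List ℕ) : ℕ :=
  ((Finset.range s.length).filter fun i => s.getD i 0 = 0).card

def maxN (s : List ℕ) : ℕ :=
  ((Finset.range s.length).filter fun i => s.getD i 0 = i).card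

def rminN (s : List ℕ) : ℕ :=
  ((Finset.range s.length).filter fun i =>
    ∀ j ∈ Finset.range s.length, i < j → s.getD i 0 < s.getD j 0).card

/-- `s` is an inversion sequence: 0-indexed, `s i ≤ i` (i.e. 1-indexed `0 ≤ s_i < i`). -/
def IsInvSeq (s : List ℕ) : Prop := ∀ i < s.length, s.getD i 0 ≤ i

/-- `s` is an ascent sequence. -/
def IsAscSeq (s : List ℕ) : Prop :=
  IsInvSeq s ∧ ∀ i < s.length, s.getD i 0 ≤ ascN (s.take i) + 1

def AscSeqs (n : ℕ) : Set (List ℕ) := {s | IsAscSeq s ∧ s.length = n}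

/-! ### A linear system over power series -/

section LinearSystem

open Finset PowerSeries

variable {A : Type*} [CommRing A]

/-- The common coefficient `1 - t (x + u - x u)`, symmetric in `x` and `u`. -/
noncomputable def symCoeff (x u : A) : A⟦X⟧ := 1 - C x * X - C u * X + C x * C u * X

lemma symCoeff_comm (x u : A) : symCoeff x u = symCoeff u x := by
  unfold symCoeff; ring

/-- The linear system governing the generating functions of extensions of a state `(k, l)`
(`k` ascents, last letter `l`, all values `0, …, k` used), with terminal weights `φ`. -/
structure IsSol (x u : A) (φ : ℕ → A⟦X⟧) (E : ℕ → ℕ → A⟦X⟧) : Prop where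
  step : ∀ k l, l < k → E k l = symCoeff x u * E k (l + 1) + C u * X * E (k + 1) (l + 1)
  diag : ∀ k, E k k = φ k + C x * X * ∑ v ∈ range (k + 1), E k v + C u * X * E (k + 1) (k + 1)

/-- The right-hand side of the transfer recursion, one letter at a time. -/
noncomputable def transfer (x u : A⟦X⟧) (E : ℕ → ℕ → A⟦X⟧) (k l : ℕ) : A⟦X⟧ :=
  x * ∑ v ∈ range (l + 1), E k v
    + u * ∑ v ∈ Ico (l + 1) (k + 1), (E (k + 1) v - (1 - x) * E k v) + u * E (k + 1) (k + 1)

lemma transfer_succ (x u : A⟦X⟧) (E : ℕ → ℕ → A⟦X⟧) {k l : ℕ} (h : l < k) :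
    transfer x u E k l = transfer x u E k (l + 1)
      + u * (E (k + 1) (l + 1) - (1 - x) * E k (l + 1)) - x * E k (l + 1) := by
  unfold transfer
  rw [Finset.sum_eq_sum_Ico_succ_bot (by omega : l + 1 < k + 1), sum_range_succ _ (l + 1)]
  ring

lemma isSol_iff (x u : A) (φ : ℕ → A⟦X⟧) (E : ℕ → ℕ → A⟦X⟧) :
    IsSol x u φ E ↔ ∀ k l, l ≤ k → E k l = φ k + X * transfer (C x) (C u) E k l := by
  constructor
  · intro h k l hl
    induction hl using Nat.decreasingInduction with
    | self => rw [h.diag k]; simp [transfer]; ring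
    | of_succ l hl ih =>
      rw [h.step k l hl, transfer_succ _ _ _ hl]
      have : symCoeff x u * E k (l + 1) = E k (l + 1)
          + (- C x * X - C u * X + C x * C u * X) * E k (l + 1) := by
        unfold symCoeff; ring
      rw [this]
      nth_rewrite 1 [ih]
      ring
  · intro h
    refine ⟨fun k l hl => ?_, fun k => ?_⟩
    · rw [h k l hl.le, transfer_succ _ _ _ hl]
      have := h k (l + 1) hl
      unfold symCoeff
      linear_combination -this
    · rw [h k k le_rfl]; simp [transfer]; ring

lemma IsSol.unique {x u : A} {φ : ℕ → A⟦X⟧} {E E' : ℕ → ℕ → A⟦X⟧} (h : IsSol x u φ E)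
    (h' : IsSol x u φ E') {k l : ℕ} (hl : l ≤ k) : E k l = E' k l := by
  rw [isSol_iff] at h h'
  ext n
  induction n generalizing k l with
  | zero => rw [h k l hl, h' k l hl]; simp
  | succ n ih =>
    rw [h k l hl, h' k l hl]
    have e1 : ∀ v ∈ range (l + 1), coeff n (E k v) = coeff n (E' k v) := fun v hv =>
      ih (by simp at hv; omega)
    have e2 : ∀ v ∈ Ico (l + 1) (k + 1), coeff n (E (k + 1) v - (1 - C x) * E k v)
        = coeff n (E' (k + 1) v - (1 - C x) * E' k v) := fun v hv => by
      simp only [sub_mul, one_mul, map_sub, coeff_C_mul]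
      simp at hv
      rw [ih (by omega), ih (by omega)]
    simp only [transfer, map_add, coeff_succ_X_mul, coeff_C_mul, map_sum]
    rw [sum_congr rfl e1, sum_congr rfl e2, ih le_rfl]

/-- The coefficients of the solution of the system. -/
noncomputable def solCoeff (x u : A) (φ : ℕ → A⟦X⟧) : ℕ → ℕ → ℕ → A
  | 0, k, _ => coeff 0 (φ k)
  | n + 1, k, l => coeff (n + 1) (φ k) + (x * ∑ v ∈ range (l + 1), solCoeff x u φ n k v
      + u * ∑ v ∈ Ico (l + 1) (k + 1),
        (solCoeff x u φ n (k + 1) v - (1 - x) * solCoeff x u φ n k v)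
      + u * solCoeff x u φ n (k + 1) (k + 1))

/-- The solution of the system. -/
noncomputable def sol (x u : A) (φ : ℕ → A⟦X⟧) (k l : ℕ) : A⟦X⟧ :=
  PowerSeries.mk fun n => solCoeff x u φ n k l

lemma isSol_sol (x u : A) (φ : ℕ → A⟦X⟧) : IsSol x u φ (sol x u φ) := by
  rw [isSol_iff]
  intro k l _
  ext n
  cases n with
  | zero => simp [sol, solCoeff]
  | succ n =>
    simp only [transfer, map_add, coeff_succ_X_mul, coeff_C_mul, map_sum, sub_mul, one_mul,
      map_sub, sol, coeff_mk, solCoeff]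

lemma sol_add (x u : A) (φ ψ : ℕ → A⟦X⟧) {k l : ℕ} (hl : l ≤ k) :
    sol x u (φ + ψ) k l = sol x u φ k l + sol x u ψ k l := by
  refine (isSol_sol x u _).unique (E' := fun k l => sol x u φ k l + sol x u ψ k l) ⟨?_, ?_⟩ hl
  · intro k l hl
    linear_combination (isSol_sol x u φ).step k l hl + (isSol_sol x u ψ).step k l hl
  · intro k
    simp only [sum_add_distrib, Pi.add_apply]
    linear_combination (isSol_sol x u φ).diag k + (isSol_sol x u ψ).diag k

lemma sol_smul (x u : A) (r : A⟦X⟧) (φ : ℕ → A⟦X⟧) {k l : ℕ} (hl : l ≤ k) :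
    sol x u (r • φ) k l = r * sol x u φ k l := by
  refine (isSol_sol x u _).unique (E' := fun k l => r * sol x u φ k l) ⟨?_, ?_⟩ hl
  · intro k l hl
    linear_combination r * (isSol_sol x u φ).step k l hl
  · intro k
    simp only [← mul_sum, Pi.smul_apply, smul_eq_mul]
    linear_combination r * (isSol_sol x u φ).diag k

/-! ### Operators on sequences of power series -/

/-- The solution of the system at last letter `0`, as an operator on terminal weights. -/
noncomputable def solOp (x u : A) : Module.End A⟦X⟧ (ℕ → A⟦X⟧) where
  toFun φ k := sol x u φ k 0
  map_add' φ ψ := funext fun k => sol_add x u φ ψ k.zero_le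
  map_smul' r φ := funext fun k => sol_smul x u r φ k.zero_le

/-- The left shift of sequences. -/
def shiftOp : Module.End A⟦X⟧ (ℕ → A⟦X⟧) where
  toFun φ k := φ (k + 1)
  map_add' _ _ := rfl
  map_smul' _ _ := rfl

/-- Extensions by positive letters from a state with last letter `0`. -/
noncomputable def posOp (x u : A) : Module.End A⟦X⟧ (ℕ → A⟦X⟧) where
  toFun φ
    | 0 => φ 0 + C u * X * solOp x u (shiftOp φ) 0
    | k + 1 => symCoeff x u * solOp x u (shiftOp φ) k + C u * X * solOp x u (shiftOp φ) (k + 1)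
  map_add' φ ψ := by
    funext k
    cases k <;> simp only [map_add, Pi.add_apply] <;> ring
  map_smul' r φ := by
    funext k
    cases k <;> simp only [map_smul, Pi.smul_apply, smul_eq_mul, RingHom.id_apply] <;> ring

/-- The conjugate of `posOp` by the shift: extensions by letters at least `2`. -/
noncomputable def posOpShift (x u : A) : Module.End A⟦X⟧ (ℕ → A⟦X⟧) where
  toFun φ
    | 0 => φ 0
    | k + 1 => posOp x u (shiftOp φ) k
  map_add' φ ψ := by
    funext k
    cases k <;> simp only [map_add, Pi.add_apply]
  map_smul' r φ := by
    funext k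
    cases k <;> simp only [map_smul, Pi.smul_apply, smul_eq_mul, RingHom.id_apply]

/-- Restriction of a sequence to index `0`. -/
def atZero : Module.End A⟦X⟧ (ℕ → A⟦X⟧) where
  toFun φ
    | 0 => φ 0
    | _ + 1 => 0
  map_add' φ ψ := by
    funext k
    cases k <;> simp
  map_smul' r φ := by
    funext k
    cases k <;> simp

lemma posOp_zero (x u : A) (φ : ℕ → A⟦X⟧) :
    posOp x u φ 0 = φ 0 + C u * X * solOp x u (shiftOp φ) 0 := rfl

lemma posOp_succ (x u : A) (φ : ℕ → A⟦X⟧) (k : ℕ) : posOp x u φ (k + 1) =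
    symCoeff x u * solOp x u (shiftOp φ) k + C u * X * solOp x u (shiftOp φ) (k + 1) := rfl

lemma posOpShift_zero (x u : A) (φ : ℕ → A⟦X⟧) : posOpShift x u φ 0 = φ 0 := rfl

lemma shiftOp_mul_posOpShift (x u : A) :
    shiftOp * posOpShift x u = posOp x u * shiftOp := rfl

lemma posOp_mul_atZero (x u : A) : posOp x u * atZero = atZero := by
  ext1 φ
  have h : shiftOp (atZero φ) = 0 := rfl
  funext k
  cases k with
  | zero => simp [posOp_zero, h]
  | succ k => simp only [Module.End.mul_apply, posOp_succ, h, map_zero]; simp [atZero]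

lemma atZero_mul_posOpShift (x u : A) : atZero * posOpShift x u = atZero := by
  ext1 φ
  funext k
  cases k <;> rfl

/-- Decomposition of an extension at its first zero. -/
lemma solOp_eq (x u : A) : solOp x u = posOp x u * (1 + (C x * X : A⟦X⟧) • solOp x u) := by
  ext1 φ
  set φ' : ℕ → A⟦X⟧ := (1 + (C x * X : A⟦X⟧) • solOp x u) φ with hφ'
  have hE := (isSol_iff x u φ _).1 (isSol_sol x u φ)
  have hφ'k : ∀ k, φ' k = φ k + C x * X * sol x u φ k 0 := fun k => rfl
  have key : ∀ k l, l ≤ k → sol x u φ (k + 1) (l + 1) = sol x u (shiftOp φ') k l := by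
    intro k l hl
    refine IsSol.unique (x := x) (u := u) (φ := shiftOp φ')
      (E := fun k l => sol x u φ (k + 1) (l + 1)) ⟨?_, ?_⟩ (isSol_sol x u _) hl
    · intro k l hl
      exact (isSol_sol x u φ).step (k + 1) (l + 1) (by omega)
    · intro k
      have := (isSol_sol x u φ).diag (k + 1)
      rw [sum_range_succ'] at this
      have h2 : (shiftOp φ') k = φ (k + 1) + C x * X * sol x u φ (k + 1) 0 := hφ'k (k + 1)
      rw [h2]
      linear_combination this
  have hk : ∀ k, solOp x u (shiftOp φ') k = sol x u φ (k + 1) 1 := fun k =>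
    (key k 0 k.zero_le).symm
  funext k
  rw [Module.End.mul_apply, ← hφ']
  cases k with
  | zero =>
    rw [posOp_zero, hk, hφ'k]
    have := (isSol_sol x u φ).diag 0
    simp only [zero_add, sum_range_one] at this
    exact this
  | succ k =>
    rw [posOp_succ, hk, hk]
    exact (isSol_sol x u φ).step (k + 1) 0 k.succ_pos

lemma eq_zero_of_eq_X_smul (L : Module.End A⟦X⟧ (ℕ → A⟦X⟧)) (D : ℕ → A⟦X⟧)
    (h : D = (X : A⟦X⟧) • L D) : D = 0 := by
  have hd : ∀ n : ℕ, ∃ D', D = (X ^ n : A⟦X⟧) • D' := by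
    intro n
    induction n with
    | zero => exact ⟨D, by simp⟩
    | succ n ih =>
      obtain ⟨D', hD'⟩ := ih
      refine ⟨L D', ?_⟩
      rw [h]
      nth_rewrite 1 [hD']
      rw [map_smul, smul_smul, pow_succ']
  funext k
  ext n
  obtain ⟨D', hD'⟩ := hd (n + 1)
  rw [hD']
  simp [coeff_X_pow_mul']

/-- Decomposition of an extension at its last zero. -/
lemma solOp_eq' (x u : A) : solOp x u = (1 + (C x * X : A⟦X⟧) • solOp x u) * posOp x u := by
  have h := solOp_eq x u
  set S := solOp x u
  set M := posOp x u
  rw [← sub_eq_zero]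
  ext1 φ
  have hD : S - (1 + (C x * X : A⟦X⟧) • S) * M
      = (X : A⟦X⟧) • ((C x : A⟦X⟧) • M * (S - (1 + (C x * X : A⟦X⟧) • S) * M)) := by
    have h1 : S = M + (C x * X : A⟦X⟧) • (M * S) := by
      nth_rewrite 1 [h]; simp [mul_add]
    have h2 : S * M = M * M + (C x * X : A⟦X⟧) • (M * S * M) := by
      nth_rewrite 1 [h1]; simp [add_mul]
    have h3 : S - (1 + (C x * X : A⟦X⟧) • S) * M
        = (C x * X : A⟦X⟧) • (M * S) - (C x * X : A⟦X⟧) • (S * M) := by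
      rw [add_mul, one_mul, smul_mul_assoc]
      nth_rewrite 1 [h1]
      abel
    have h4 : M * (S - (1 + (C x * X : A⟦X⟧) • S) * M) = M * S - S * M := by
      rw [h2]
      simp only [mul_sub, mul_add, add_mul, one_mul, smul_mul_assoc, mul_smul_comm, mul_assoc]
    rw [smul_mul_assoc, h4, smul_smul, mul_comm X, smul_sub, h3]
  exact eq_zero_of_eq_X_smul ((C x : A⟦X⟧) • M) _ (by nth_rewrite 1 [hD]; rfl)

lemma posOp_eq (x u : A) : posOp x u = symCoeff x u • posOpShift x u
    + (C x * X : A⟦X⟧) • (posOp x u * posOpShift x u)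
    + (C u * X : A⟦X⟧) • (posOp x u * shiftOp) + (C u * X * (1 - C x) : A⟦X⟧) • atZero := by
  ext1 φ
  have hS : ∀ k, solOp x u (shiftOp φ) k = posOp x u (shiftOp φ) k
      + C x * X * solOp x u (posOp x u (shiftOp φ)) k := fun k => by
    nth_rewrite 1 [solOp_eq' x u]; rfl
  have hs : shiftOp (posOpShift x u φ) = posOp x u (shiftOp φ) := rfl
  funext k
  simp only [LinearMap.add_apply, LinearMap.smul_apply, Module.End.mul_apply, Pi.add_apply,
    Pi.smul_apply, smul_eq_mul]
  cases k with
  | zero =>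
    rw [posOp_zero x u φ, posOp_zero x u (posOpShift x u φ), hs, hS 0, posOpShift_zero]
    have : atZero φ 0 = φ 0 := rfl
    rw [this]
    unfold symCoeff
    ring
  | succ k =>
    rw [posOp_succ x u φ, posOp_succ x u (posOpShift x u φ), hs, hS k, hS (k + 1)]
    have : atZero φ (k + 1) = 0 := rfl
    have h' : posOpShift x u φ (k + 1) = posOp x u (shiftOp φ) k := rfl
    rw [this, h']
    ring

/-- Extensions by positive letters that contain the letter `1`. -/
noncomputable def oneOp (x u : A) : Module.End A⟦X⟧ (ℕ → A⟦X⟧) := posOp x u - posOpShift x u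

lemma posOp_mul_oneOp (x u : A) : posOp x u * oneOp x u =
    symCoeff x u • (oneOp x u * posOpShift x u)
      + (C x * X : A⟦X⟧) • (posOp x u * oneOp x u * posOpShift x u) := by
  have h := posOp_eq x u
  have h1 := congrArg (posOp x u * ·) h
  have h2 := congrArg (· * posOpShift x u) h
  simp only [mul_add, add_mul, mul_smul_comm, smul_mul_assoc, posOp_mul_atZero,
    atZero_mul_posOpShift, mul_assoc, shiftOp_mul_posOpShift] at h1 h2
  simp only [oneOp, mul_sub, sub_mul, mul_assoc, smul_sub]
  have h3 := congrArg₂ (· - ·) h1 h2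
  rw [h3]
  abel

lemma oneOp_apply_zero (x u : A) (ψ : ℕ → A⟦X⟧) : oneOp x u ψ 0 =
    C x * X * oneOp x u (posOpShift x u ψ) 0 + C u * X * posOp x u (shiftOp ψ) 0 := by
  have h := congrFun (LinearMap.congr_fun (posOp_eq x u) ψ) 0
  simp only [LinearMap.add_apply, LinearMap.smul_apply, Module.End.mul_apply, Pi.add_apply,
    Pi.smul_apply, smul_eq_mul, posOpShift_zero] at h
  have h0 : atZero ψ 0 = ψ 0 := rfl
  rw [h0] at h
  simp only [oneOp, LinearMap.sub_apply, Pi.sub_apply, posOpShift_zero]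
  rw [h]
  unfold symCoeff
  ring

lemma sum_pow_mul_sub_mul_pow {R : Type*} [Ring R] (a b : R) (k : ℕ) :
    ∑ c ∈ range (k + 1), a ^ (k - c) * (a - b) * b ^ c = a ^ (k + 1) - b ^ (k + 1) := by
  induction k with
  | zero => simp
  | succ k ih =>
    rw [sum_range_succ]
    have : ∀ c ∈ range (k + 1), a ^ (k + 1 - c) * (a - b) * b ^ c
        = a * (a ^ (k - c) * (a - b) * b ^ c) := fun c hc => by
      rw [show k + 1 - c = (k - c) + 1 by simp at hc; omega, pow_succ']
      simp only [mul_assoc]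
    rw [sum_congr rfl this, ← mul_sum, ih]
    simp only [Nat.sub_self, pow_zero, one_mul, mul_sub, sub_mul, ← pow_succ']
    abel

lemma posOpShift_pow_apply_zero (x u : A) (c : ℕ) (φ : ℕ → A⟦X⟧) :
    (posOpShift x u ^ c) φ 0 = φ 0 := by
  induction c with
  | zero => rfl
  | succ c ih => rw [pow_succ', Module.End.mul_apply, posOpShift_zero, ih]

lemma shiftOp_mul_posOpShift_pow (x u : A) (c : ℕ) :
    shiftOp * posOpShift x u ^ c = posOp x u ^ c * shiftOp :=
  (SemiconjBy.pow_right (shiftOp_mul_posOpShift x u : SemiconjBy _ _ _) c)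

/-- Refining by the zeros before and after the last letter `1` solves the system with the
roles of `x` and `u` exchanged. -/
lemma isSol_swap (x u : A) : IsSol u x (fun _ => C u * X)
    (fun k c => (posOp x u ^ (k - c) * oneOp x u * posOpShift x u ^ c) 1 0) := by
  constructor
  · intro k c hc
    have h := congrArg (fun L => posOp x u ^ (k - (c + 1)) * L * posOpShift x u ^ c)
      (posOp_mul_oneOp x u)
    have e1 : posOp x u ^ (k - (c + 1)) * (posOp x u * oneOp x u) * posOpShift x u ^ c
        = posOp x u ^ (k - c) * oneOp x u * posOpShift x u ^ c := by
      rw [show k - c = k - (c + 1) + 1 by omega, pow_succ]; simp only [mul_assoc]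
    have e2 : posOp x u ^ (k - (c + 1)) * (posOp x u * oneOp x u * posOpShift x u)
        * posOpShift x u ^ c
        = posOp x u ^ (k + 1 - (c + 1)) * oneOp x u * posOpShift x u ^ (c + 1) := by
      rw [show k + 1 - (c + 1) = k - (c + 1) + 1 by omega, pow_succ, pow_succ']
      simp only [mul_assoc]
    have e3 : posOp x u ^ (k - (c + 1)) * (oneOp x u * posOpShift x u) * posOpShift x u ^ c
        = posOp x u ^ (k - (c + 1)) * oneOp x u * posOpShift x u ^ (c + 1) := by
      rw [pow_succ' (posOpShift x u)]; simp only [mul_assoc]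
    simp only [mul_add, add_mul, mul_smul_comm, smul_mul_assoc] at h
    rw [e1, e2, e3] at h
    have h' := congrFun (LinearMap.congr_fun h 1) 0
    simp only [LinearMap.add_apply, LinearMap.smul_apply, Pi.add_apply, Pi.smul_apply,
      smul_eq_mul] at h'
    rw [symCoeff_comm u x]
    exact h'
  · intro k
    have hsum := congrFun (LinearMap.congr_fun
      (sum_pow_mul_sub_mul_pow (posOp x u) (posOpShift x u) k) 1) 0
    simp only [LinearMap.sum_apply, Finset.sum_apply, LinearMap.sub_apply, Pi.sub_apply,
      posOpShift_pow_apply_zero] at hsum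
    change ∑ c ∈ range (k + 1), (posOp x u ^ (k - c) * oneOp x u * posOpShift x u ^ c) 1 0 = _
      at hsum
    rw [hsum]
    have h := oneOp_apply_zero x u ((posOpShift x u ^ k) 1)
    have hs : shiftOp ((posOpShift x u ^ k) 1) = (posOp x u ^ k) 1 :=
      LinearMap.congr_fun (shiftOp_mul_posOpShift_pow x u k) 1
    rw [hs] at h
    simp only [Nat.sub_self, pow_zero, one_mul, Module.End.mul_apply, pow_succ', Pi.one_apply]
    linear_combination h

theorem sol_one_symm [IsDomain A] (x : A) {u : A} (hu : u ≠ 0) :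
    sol x u 1 0 0 = sol u x 1 0 0 := by
  have h1 := (isSol_swap x u).unique (isSol_sol u x _) (le_refl 0)
  have h2 : (fun _ => C u * X : ℕ → A⟦X⟧) = (C u * X : A⟦X⟧) • 1 := by
    funext k; simp
  rw [h2, sol_smul u x _ _ le_rfl] at h1
  have h3 : (oneOp x u 1) 0 = C u * X * sol x u 1 0 0 := by
    have : (shiftOp 1 : ℕ → A⟦X⟧) = 1 := rfl
    simp only [oneOp, LinearMap.sub_apply, Pi.sub_apply, posOpShift_zero, posOp_zero, this]
    simp [solOp]
  simp only [Nat.sub_self, pow_zero, one_mul, mul_one] at h1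
  rw [h3] at h1
  refine mul_left_cancel₀ (mul_ne_zero ?_ X_ne_zero) h1
  exact (map_ne_zero_iff _ C_injective).2 hu

end LinearSystem

/-! ### Weighted enumeration of extensions of an ascent sequence -/

section Extensions

open Finset PowerSeries

variable {A : Type*} [CommRing A]

/-- The weighted number of ways to append `n` letters to an ascent sequence with `k` ascents,
last letter `l` and set of values `S`; new ascents have weight `u` and repetitions `x`. -/
def extWeight (x u : A) : ℕ → ℕ → ℕ → Finset ℕ → A
  | 0, _, _, _ => 1
  | n + 1, k, l, S => ∑ v ∈ range (k + 2), (if l < v then u else 1) * (if v ∈ S then x else 1)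
      * extWeight x u n (if l < v then k + 1 else k) v (insert v S)

/-- The increasing map on naturals omitting exactly the value `i`. -/
def skip (i m : ℕ) : ℕ := if m < i then m else m + 1

lemma skip_ne (i m : ℕ) : skip i m ≠ i := by unfold skip; split_ifs <;> omega

lemma skip_lt_skip {i l m : ℕ} : skip i l < skip i m ↔ l < m := by
  unfold skip; split_ifs <;> omega

lemma skip_injective (i : ℕ) : Function.Injective (skip i) := fun a b h => by
  unfold skip at h; split_ifs at h <;> omega

lemma sum_range_succ_skip (f : ℕ → A) {i N : ℕ} (h : i ≤ N) :
    ∑ v ∈ range (N + 1), f v = f i + ∑ w ∈ range N, f (skip i w) := by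
  induction N, h using Nat.le_induction with
  | base =>
    rw [sum_range_succ, add_comm]
    congr 1
    exact sum_congr rfl fun w hw => by simp [skip, mem_range.1 hw]
  | succ N hN ih =>
    rw [sum_range_succ, ih, sum_range_succ _ N, show skip i N = N + 1 by
      unfold skip; rw [if_neg (by omega)]]
    ring

/-- Marking an unused value `i` as used: either it never occurs, and can be removed, or its
first occurrence becomes a repetition. -/
lemma extWeight_insert_skip (x u : A) (n : ℕ) {i k : ℕ} (hi : i ≤ k + 2) (l : ℕ) (S : Finset ℕ) :
    extWeight x u n (k + 1) (skip i l) (insert i (S.image (skip i))) =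
      x * extWeight x u n (k + 1) (skip i l) (S.image (skip i))
        + (1 - x) * extWeight x u n k l S := by
  induction n generalizing k l S with
  | zero => simp [extWeight]
  | succ n ih =>
    have hni : i ∉ S.image (skip i) := by
      simp only [mem_image, not_exists, not_and]; exact fun m _ => skip_ne i m
    simp only [extWeight]
    rw [sum_range_succ_skip _ hi, sum_range_succ_skip _ hi]
    rw [mul_add, add_assoc (x * _), mul_sum (range (k + 2)), mul_sum (range (k + 2)),
      ← sum_add_distrib]
    refine congrArg₂ (· + ·) ?_ (sum_congr rfl fun w _ => ?_)
    · simp only [mem_insert_self, if_true, hni, if_false, insert_idem]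
      ring
    · have hm : skip i w ∈ S.image (skip i) ↔ w ∈ S := by
        simp [mem_image, (skip_injective i).eq_iff]
      have e : (if l < w then k + 1 + 1 else k + 1) = (if l < w then k + 1 else k) + 1 := by
        split_ifs <;> rfl
      simp only [mem_insert, skip_ne, false_or, hm, skip_lt_skip]
      rw [insert_comm, ← image_insert, e, ih (by split_ifs <;> omega)]
      ring

lemma extWeight_range_step (x u : A) (n k v : ℕ) (hv : v ≤ k) :
    x * extWeight x u n (k + 1) v (range (k + 1)) =
      extWeight x u n (k + 1) v (range (k + 2)) - (1 - x) * extWeight x u n k v (range (k + 1)) := by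
  have h := extWeight_insert_skip x u n (i := k + 1) (k := k) (by omega) v (range (k + 1))
  have e : (range (k + 1)).image (skip (k + 1)) = range (k + 1) := by
    rw [image_congr (g := id), image_id]
    intro m hm
    simp only [coe_range, Set.mem_Iio] at hm
    simp [skip, hm]
  have e' : skip (k + 1) v = v := by unfold skip; rw [if_pos (by omega)]
  rw [e, e', ← range_add_one] at h
  rw [h]
  ring

lemma coeff_sol_one (x u : A) (n : ℕ) {k l : ℕ} (hl : l ≤ k) :
    coeff n (sol x u 1 k l) = extWeight x u n k l (range (k + 1)) := by
  simp only [sol, coeff_mk]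
  induction n generalizing k l with
  | zero => simp [solCoeff, extWeight]
  | succ n ih =>
    have hz : coeff (n + 1) ((1 : ℕ → A⟦X⟧) k) = 0 := by simp [coeff_one]
    rw [solCoeff, extWeight, hz, zero_add, sum_range_succ _ (k + 1),
      ← sum_range_add_sum_Ico _ (by omega : l + 1 ≤ k + 1), mul_sum, mul_sum]
    congr 1
    · congr 1
      · refine sum_congr rfl fun v hv => ?_
        rw [mem_range] at hv
        have h1 : v ∈ range (k + 1) := mem_range.2 (by omega)
        rw [if_neg (by omega), if_pos h1, if_neg (by omega), insert_eq_of_mem h1, ih (by omega)]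
        ring
      · refine sum_congr rfl fun v hv => ?_
        rw [mem_Ico] at hv
        have h1 : v ∈ range (k + 1) := mem_range.2 (by omega)
        rw [if_pos (by omega), if_pos h1, if_pos (by omega), insert_eq_of_mem h1, ih (by omega),
          ih (by omega), mul_assoc, extWeight_range_step x u n k v (by omega)]
    · rw [if_pos (by omega), if_neg (by simp), if_pos (by omega), ← range_add_one, ih le_rfl]
      ring

end Extensions

/-! ### Ascent sequences -/

section AscentSequences

open Finset

lemma ascN_append_singleton {s : List ℕ} (hs : s ≠ []) (v : ℕ) :
    ascN (s ++ [v]) = ascN s + if s.getLastD 0 < v then 1 else 0 := by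
  obtain ⟨m, hm⟩ : ∃ m, s.length = m + 1 := ⟨s.length - 1, by
    have := List.length_pos_iff.2 hs; omega⟩
  have hlast : s.getLastD 0 = s.getD m 0 := by
    rw [List.getLastD_eq_getLast?, List.getLast?_eq_getElem?, hm, List.getD_eq_getElem?_getD]
    simp
  have h1 : ∀ i, i < m + 1 → (s ++ [v]).getD i 0 = s.getD i 0 := fun i hi =>
    List.getD_append _ _ _ _ (by omega)
  have h2 : (s ++ [v]).getD (m + 1) 0 = v := by
    rw [List.getD_append_right _ _ _ _ (by omega), hm]; simp
  unfold ascN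
  rw [List.length_append, hm, List.length_singleton, Nat.add_sub_cancel, Nat.add_sub_cancel,
    range_add_one, filter_insert, h2, h1 m (by omega), hlast]
  have h3 : (range m).filter (fun i => (s ++ [v]).getD i 0 < (s ++ [v]).getD (i + 1) 0)
      = (range m).filter (fun i => s.getD i 0 < s.getD (i + 1) 0) :=
    filter_congr fun i hi => by
      rw [mem_range] at hi
      rw [h1 i (by omega), h1 (i + 1) (by omega)]
  rw [h3]
  split_ifs
  · rw [card_insert_of_notMem (by simp)]
  · rfl

lemma ascN_add_one_le_length {s : List ℕ} (hs : s ≠ []) : ascN s + 1 ≤ s.length := by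
  have h := card_filter_le (range (s.length - 1)) fun i => s.getD i 0 < s.getD (i + 1) 0
  rw [card_range] at h
  have := List.length_pos_iff.2 hs
  unfold ascN
  omega

lemma repN_eq (s : List ℕ) : repN s = s.length - s.toFinset.card := by
  rw [repN, List.card_toFinset]

lemma repN_append_singleton (s : List ℕ) (v : ℕ) :
    repN (s ++ [v]) = repN s + if v ∈ s.toFinset then 1 else 0 := by
  have h : (s ++ [v]).toFinset = insert v s.toFinset := by
    ext; simp
  have hle := List.toFinset_card_le s
  rw [repN_eq, repN_eq, h, List.length_append, List.length_singleton]
  split_ifs with hv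
  · rw [insert_eq_of_mem hv]; omega
  · rw [card_insert_of_notMem hv]; omega

lemma isAscSeq_append_singleton {s : List ℕ} (hs : s ≠ []) (v : ℕ) :
    IsAscSeq (s ++ [v]) ↔ IsAscSeq s ∧ v ≤ ascN s + 1 := by
  have h1 : ∀ i, i < s.length → (s ++ [v]).getD i 0 = s.getD i 0 := fun i hi =>
    List.getD_append _ _ _ _ hi
  have h2 : (s ++ [v]).getD s.length 0 = v := by
    rw [List.getD_append_right _ _ _ _ le_rfl]; simp
  have h3 : ∀ i, i ≤ s.length → (s ++ [v]).take i = s.take i := fun i hi =>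
    List.take_append_of_le_length hi
  have hle := ascN_add_one_le_length hs
  unfold IsAscSeq IsInvSeq
  simp only [List.length_append, List.length_singleton]
  constructor
  · rintro ⟨ha, hb⟩
    refine ⟨⟨fun i hi => ?_, fun i hi => ?_⟩, ?_⟩
    · rw [← h1 i hi]; exact ha i (by omega)
    · rw [← h1 i hi, ← h3 i hi.le]; exact hb i (by omega)
    · have := hb s.length (by omega)
      rwa [h2, h3 _ le_rfl, List.take_length] at this
  · rintro ⟨⟨ha, hb⟩, hv⟩
    refine ⟨fun i hi => ?_, fun i hi => ?_⟩ <;>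
      rcases (Nat.lt_succ_iff.1 hi).lt_or_eq with h | rfl
    · rw [h1 i h]; exact ha i h
    · rw [h2]; omega
    · rw [h1 i h, h3 i h.le]; exact hb i h
    · rwa [h2, h3 _ le_rfl, List.take_length]

/-- The finset of ascent sequences of length `n + 1`. -/
def ascSeqFinset : ℕ → Finset (List ℕ)
  | 0 => {[0]}
  | n + 1 => ((ascSeqFinset n).sigma fun s => range (ascN s + 2)).image fun p => p.1 ++ [p.2]

lemma mem_ascSeqFinset {n : ℕ} {s : List ℕ} :
    s ∈ ascSeqFinset n ↔ IsAscSeq s ∧ s.length = n + 1 := by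
  induction n generalizing s with
  | zero =>
    simp only [ascSeqFinset, mem_singleton, zero_add]
    constructor
    · rintro rfl
      simp [IsAscSeq, IsInvSeq]
    · rintro ⟨⟨h, -⟩, hl⟩
      obtain ⟨a, rfl⟩ := List.length_eq_one_iff.1 hl
      have := h 0 (by simp)
      simpa using this
  | succ n ih =>
    simp only [ascSeqFinset, mem_image, mem_sigma, mem_range, Sigma.exists]
    constructor
    · rintro ⟨s, v, ⟨hs, hv⟩, rfl⟩
      obtain ⟨h1, h2⟩ := ih.1 hs
      have hne : s ≠ [] := by rintro rfl; simp at h2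
      exact ⟨(isAscSeq_append_singleton hne v).2 ⟨h1, by omega⟩, by simp [h2]⟩
    · rintro ⟨h1, h2⟩
      have hne : s ≠ [] := by rintro rfl; simp at h2
      obtain ⟨t, v, rfl⟩ : ∃ t v, s = t ++ [v] :=
        ⟨s.dropLast, s.getLast hne, (List.dropLast_append_getLast hne).symm⟩
      have hl : t.length = n + 1 := by simpa using h2
      have hne' : t ≠ [] := by rintro rfl; simp at hl
      obtain ⟨h3, h4⟩ := (isAscSeq_append_singleton hne' v).1 h1
      exact ⟨t, v, ⟨ih.2 ⟨h3, hl⟩, by omega⟩, rfl⟩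

lemma ne_nil_of_mem_ascSeqFinset {n : ℕ} {s : List ℕ} (h : s ∈ ascSeqFinset n) : s ≠ [] := by
  rintro rfl
  have := (mem_ascSeqFinset.1 h).2
  simp at this

variable {A : Type*} [CommRing A]

lemma sum_ascSeqFinset_mul_extWeight (x u : A) (n j : ℕ) :
    ∑ s ∈ ascSeqFinset n, u ^ ascN s * x ^ repN s
        * extWeight x u j (ascN s) (s.getLastD 0) s.toFinset
      = extWeight x u (n + j) 0 0 {0} := by
  induction n generalizing j with
  | zero => simp [ascSeqFinset, ascN, repN]
  | succ n ih =>
    rw [ascSeqFinset, sum_image, sum_sigma, show n + 1 + j = n + (j + 1) by ring, ← ih (j + 1)]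
    · refine sum_congr rfl fun s hs => ?_
      rw [extWeight, mul_sum]
      refine sum_congr rfl fun v _ => ?_
      have h : (s ++ [v]).toFinset = insert v s.toFinset := by
        ext; simp
      have hl : (s ++ [v]).getLastD 0 = v := by simp
      dsimp only
      rw [ascN_append_singleton (ne_nil_of_mem_ascSeqFinset hs), repN_append_singleton, h, hl]
      split_ifs <;> simp only [pow_succ, add_zero] <;> ring
    · rintro ⟨s, v⟩ _ ⟨s', v'⟩ _ h
      obtain ⟨rfl, h2⟩ := List.append_inj' h rfl
      simp at h2
      rw [h2]

lemma sum_ascSeqFinset_eq_extWeight (x u : A) (n : ℕ) :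
    ∑ s ∈ ascSeqFinset n, u ^ ascN s * x ^ repN s = extWeight x u n 0 0 {0} := by
  simpa [extWeight] using sum_ascSeqFinset_mul_extWeight x u n 0

lemma sum_ascSeqFinset_symm [IsDomain A] (x : A) {u : A} (hu : u ≠ 0) (n : ℕ) :
    ∑ s ∈ ascSeqFinset n, u ^ ascN s * x ^ repN s =
      ∑ s ∈ ascSeqFinset n, x ^ ascN s * u ^ repN s := by
  have h := congrArg (PowerSeries.coeff n) (sol_one_symm x hu)
  rw [coeff_sol_one x u n le_rfl, coeff_sol_one u x n le_rfl] at h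
  rw [sum_ascSeqFinset_eq_extWeight, sum_ascSeqFinset_eq_extWeight]
  simpa using h

lemma ncard_eq_card_filter (n a b : ℕ) :
    {s : List ℕ | IsAscSeq s ∧ s.length = n + 1 ∧ ascN s = a ∧ repN s = b}.ncard =
      ((ascSeqFinset n).filter fun s => ascN s = a ∧ repN s = b).card := by
  rw [← Set.ncard_coe_finset]
  congr 1
  ext s
  simp only [coe_filter, mem_ascSeqFinset, Set.mem_ofPred_eq, and_assoc]

lemma coeff_coeff_X_pow_mul (i j a b : ℕ) :
    (((Polynomial.X ^ i * Polynomial.C Polynomial.X ^ j :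
      Polynomial (Polynomial ℤ))).coeff a).coeff b = if i = a ∧ j = b then 1 else 0 := by
  rw [← Polynomial.C_pow, Polynomial.coeff_mul_C, Polynomial.coeff_X_pow]
  by_cases h : i = a <;> by_cases h₂ : j = b <;>
    simp [h, h₂, Ne.symm, Polynomial.coeff_X_pow]

end AscentSequences

/-- The pair `(asc, rep)` is symmetric on ascent sequences of length `n ≥ 1`. -/
theorem asc_rep_symmetric_ascent (n : ℕ) (hn : 1 ≤ n) (a b : ℕ) :
    {s : List ℕ | IsAscSeq s ∧ s.length = n ∧ ascN s = a ∧ repN s = b}.ncard =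
    {s : List ℕ | IsAscSeq s ∧ s.length = n ∧ ascN s = b ∧ repN s = a}.ncard := by
  obtain ⟨n, rfl⟩ : ∃ m, n = m + 1 := ⟨n - 1, by omega⟩
  rw [ncard_eq_card_filter, ncard_eq_card_filter]
  have h := congrArg (fun p : Polynomial (Polynomial ℤ) => (p.coeff a).coeff b)
    (sum_ascSeqFinset_symm (Polynomial.C Polynomial.X) (u := Polynomial.X)
      Polynomial.X_ne_zero n)
  simp only [mul_comm (Polynomial.C (Polynomial.X : Polynomial ℤ) ^ _), Polynomial.finsetSum_coeff,
    coeff_coeff_X_pow_mul, Finset.sum_boole] at h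
  simp only [and_comm (a := ascN _ = b)]
  exact_mod_cast h
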